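/- For any q ∈ [T, 2), where T is the real root of x³ = x² + x + 1, there exists x ∈ [0,1/(q-1)] which has exactly two expansions in base q; that is, [T, 2) ⊆ B_2. -/

import Mathlib

noncomputable section

/-- `a` is an expansion of `x` in base `q`: all digits `a n` lie in `{0,1}` and
`x = Σ_{n≥1} a_n q^{-n}` (here `a n` is the `(n+1)`-st digit, i.e. indexing is 0-based). -/
def IsExpansion (q x : ℝ) (a : ℕ → ℕ) : Prop :=
  (∀ n, a n ≤ 1) ∧ x = ∑' n : ℕ, (a n : ℝ) / q ^ (n + 1)

/-- The set of expansions of `x` in base `q`. -/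
def expansionsOf (q x : ℝ) : Set (ℕ → ℕ) := {a | IsExpansion q x a}

/-- `U_q`: the set of `x ∈ [0, 1/(q-1)]` having a unique expansion in base `q`. -/
def uniqueExpansionSet (q : ℝ) : Set ℝ :=
  {x | x ∈ Set.Icc 0 (1 / (q - 1)) ∧ ∃! a, IsExpansion q x a}

/-- `B_m` (for finite `m`): bases `q ∈ (G, 2)` for which some `x ∈ I_q` has exactly `m`
expansions in base `q`. -/
def B (m : ℕ) : Set ℝ :=
  {q | q ∈ Set.Ioo ((1 + Real.sqrt 5) / 2) 2 ∧
    ∃ x ∈ Set.Icc (0:ℝ) (1 / (q - 1)), Cardinal.mk (expansionsOf q x) = m}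

/-- `B_{ℵ₀}`: bases `q ∈ (G, 2)` for which some `x ∈ I_q` has exactly countably infinitely
many expansions in base `q`. -/
def Baleph0 : Set ℝ :=
  {q | q ∈ Set.Ioo ((1 + Real.sqrt 5) / 2) 2 ∧
    ∃ x ∈ Set.Icc (0:ℝ) (1 / (q - 1)), Cardinal.mk (expansionsOf q x) = Cardinal.aleph0}

/-- The Thue–Morse sequence: `thueMorse n` is the parity of the number of 1s in the
binary expansion of `n`. -/
def thueMorse (n : ℕ) : ℕ := ((Nat.digits 2 n).count 1) % 2

/-- A digit `a m` of an expansion of `x` in base `q` is forced if every expansion of `x`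
agreeing with `a` before position `m` also agrees at position `m`. -/
def Forced (q x : ℝ) (a : ℕ → ℕ) (m : ℕ) : Prop :=
  ∀ c : ℕ → ℕ, IsExpansion q x c → (∀ i < m, c i = a i) → c m = a m

open Filter Topology

/-- If the larger of two scales `u`, `v` is split by the two contractions, one of the two parts
still reaches `z`. -/
lemma exists_piece {r u v z : ℝ} (hr1 : r < 1) (hr2 : 1 ≤ r + 2 * r ^ 2)
    (huv : r ^ 2 * |u| ≤ |v|) (hz : |z| ≤ |u| + |v|) :
    |z - u * (1 - r)| ≤ r * |u| + |v| ∨ |z + u * (1 - r ^ 2)| ≤ r ^ 2 * |u| + |v| := by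
  by_contra! h
  obtain ⟨h1, h2⟩ := h
  have hz' := abs_le.1 hz
  rcases abs_cases u with ⟨hu, hu0⟩ | ⟨hu, hu0⟩ <;> rw [hu] at h1 h2 huv hz' <;>
  rcases lt_abs.1 h1 with h1 | h1 <;> rcases lt_abs.1 h2 with h2 | h2 <;> nlinarith

lemma exists_approx {r R : ℝ} (hr0 : 0 < r) (hr1 : r < 1) (hr2 : 1 ≤ r + 2 * r ^ 2) {K : Set ℝ}
    (hK : ∀ k ∈ K, |k| ≤ R) (hne : K.Nonempty) (h1 : ∀ k ∈ K, (1 - r) - r * k ∈ K)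
    (h2 : ∀ k ∈ K, -(1 - r ^ 2) - r ^ 2 * k ∈ K) (n : ℕ) :
    ∀ u v z : ℝ, r ^ 2 * |u| ≤ |v| → r ^ 2 * |v| ≤ |u| → |z| ≤ |u| + |v| →
      ∃ k₁ ∈ K, ∃ k₂ ∈ K, |z - u * k₁ - v * k₂| ≤ ((1 + r) / 2) ^ n * ((1 + R) * (|u| + |v|)) := by
  induction n with
  | zero =>
    intro u v z _ _ hz
    obtain ⟨k, hk⟩ := hne
    refine ⟨k, hk, k, hk, ?_⟩
    have h3 := abs_sub (z - u * k) (v * k)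
    have h4 := abs_sub z (u * k)
    rw [abs_mul] at h3 h4
    have := hK k hk
    have := mul_le_mul_of_nonneg_left this (abs_nonneg u)
    have := mul_le_mul_of_nonneg_left (hK k hk) (abs_nonneg v)
    simp only [pow_zero, one_mul]
    linarith
  | succ n ih =>
    have hR : 0 ≤ 1 + R := by
      obtain ⟨k, hk⟩ := hne
      linarith [hK k hk, abs_nonneg k]
    have key : ∀ u v z : ℝ, |v| ≤ |u| → r ^ 2 * |u| ≤ |v| → |z| ≤ |u| + |v| →
        ∃ k₁ ∈ K, ∃ k₂ ∈ K,
          |z - u * k₁ - v * k₂| ≤ ((1 + r) / 2) ^ (n + 1) * ((1 + R) * (|u| + |v|)) := by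
      intro u v z hvu huv hz
      have hu := abs_nonneg u
      have hrr : r ^ 2 ≤ r := by nlinarith
      have hr4 : r ^ 2 * r ≤ r ^ 2 := by nlinarith [sq_nonneg r]
      have hpiece : ∀ e w : ℝ, 0 < w → r ^ 2 ≤ w → w ≤ r → (∀ k ∈ K, e - w * k ∈ K) →
          |z - u * e| ≤ w * |u| + |v| → ∃ k₁ ∈ K, ∃ k₂ ∈ K,
          |z - u * k₁ - v * k₂| ≤ ((1 + r) / 2) ^ (n + 1) * ((1 + R) * (|u| + |v|)) := by
        intro e w hw0 hw hw' hmap hzu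
        have habs : |-(w * u)| = w * |u| := by rw [abs_neg, abs_mul, abs_of_pos hw0]
        obtain ⟨k₁, hk₁, k₂, hk₂, h⟩ := ih (-(w * u)) v (z - u * e)
          (by rw [habs]; nlinarith [mul_nonneg (sq_nonneg r) hu])
          (by rw [habs]; nlinarith [sq_nonneg r]) (by rwa [habs])
        refine ⟨_, hmap k₁ hk₁, k₂, hk₂, ?_⟩
        rw [habs] at h
        calc |z - u * (e - w * k₁) - v * k₂| = |z - u * e - -(w * u) * k₁ - v * k₂| := by
              congr 1; ring
          _ ≤ _ := h
          _ ≤ ((1 + r) / 2) ^ n * ((1 + R) * ((1 + r) / 2 * (|u| + |v|))) := by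
              gcongr
              nlinarith
          _ = _ := by ring
      rcases exists_piece hr1 hr2 huv hz with h | h
      · exact hpiece _ r hr0 hrr le_rfl h1 h
      · refine hpiece _ (r ^ 2) (by positivity) le_rfl hrr h2 ?_
        rwa [mul_neg, sub_neg_eq_add]
    intro u v z huv hvu hz
    rcases le_total |v| |u| with h | h
    · exact key u v z h huv hz
    · obtain ⟨k₁, hk₁, k₂, hk₂, h⟩ := key v u z h hvu (by linarith)
      refine ⟨k₂, hk₂, k₁, hk₁, ?_⟩
      rw [add_comm |u|]
      convert h using 2
      ring

/-- A compact set invariant under two orientation-reversing contractions of ratios `r` and `r²`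
which split `[-1, 1]` leaving a gap at most as long as the shorter part satisfies
`[-2, 2] ⊆ K + K`. -/
lemma exists_add_eq {r : ℝ} (hr0 : 0 < r) (hr1 : r < 1) (hr2 : 1 ≤ r + 2 * r ^ 2) {K : Set ℝ}
    (hK : IsCompact K) (hne : K.Nonempty) (h1 : ∀ k ∈ K, (1 - r) - r * k ∈ K)
    (h2 : ∀ k ∈ K, -(1 - r ^ 2) - r ^ 2 * k ∈ K) {z : ℝ} (hz : |z| ≤ 2) :
    ∃ k₁ ∈ K, ∃ k₂ ∈ K, k₁ + k₂ = z := by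
  obtain ⟨R, hR⟩ := hK.isBounded.exists_norm_le
  have hcl : IsClosed ((fun p : ℝ × ℝ => p.1 + p.2) '' K ×ˢ K) :=
    ((hK.prod hK).image (by fun_prop)).isClosed
  have hmem : z ∈ closure ((fun p : ℝ × ℝ => p.1 + p.2) '' K ×ˢ K) := by
    rw [Metric.mem_closure_iff]
    intro ε hε
    have hlim : Tendsto (fun n : ℕ => ((1 + r) / 2) ^ n * ((1 + R) * (|(1 : ℝ)| + |(1 : ℝ)|)))
        atTop (𝓝 0) := by
      simpa using (tendsto_pow_atTop_nhds_zero_of_lt_one (r := (1 + r) / 2) (by linarith)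
        (by linarith)).mul_const ((1 + R) * (|(1 : ℝ)| + |(1 : ℝ)|))
    obtain ⟨n, hn⟩ := (hlim.eventually (gt_mem_nhds hε)).exists
    obtain ⟨k₁, hk₁, k₂, hk₂, h⟩ := exists_approx hr0 hr1 hr2 hR hne h1 h2 n 1 1 z
      (by rw [abs_one]; nlinarith) (by rw [abs_one]; nlinarith) (by rw [abs_one]; linarith)
    refine ⟨k₁ + k₂, ⟨(k₁, k₂), ⟨hk₁, hk₂⟩, rfl⟩, ?_⟩
    rw [Real.dist_eq]
    refine lt_of_le_of_lt ?_ hn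
    rwa [one_mul, one_mul, sub_sub] at h
  rw [hcl.closure_eq] at hmem
  obtain ⟨⟨k₁, k₂⟩, ⟨hk₁, hk₂⟩, h⟩ := hmem
  exact ⟨k₁, hk₁, k₂, hk₂, h⟩

/-- The value of a digit sequence in base `q`. -/
def baseValue (q : ℝ) (a : ℕ → ℕ) : ℝ := ∑' n : ℕ, (a n : ℝ) / q ^ (n + 1)

/-- Prepend a digit to a sequence. -/
def seqCons (d : ℕ) (a : ℕ → ℕ) : ℕ → ℕ
  | 0 => d
  | n + 1 => a n

/-- Exchange the digits `0` and `1`. -/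
def reflection (a : ℕ → ℕ) : ℕ → ℕ := fun n => 1 - a n

lemma seqCons_le {d : ℕ} {a : ℕ → ℕ} (hd : d ≤ 1) (ha : ∀ n, a n ≤ 1) (n : ℕ) :
    seqCons d a n ≤ 1 := by
  cases n
  · exact hd
  · exact ha _

lemma reflection_le (a : ℕ → ℕ) (n : ℕ) : reflection a n ≤ 1 := Nat.sub_le _ _

lemma hasSum_div_pow {q : ℝ} (hq : 1 < q) :
    HasSum (fun n : ℕ => (1 : ℝ) / q ^ (n + 1)) (1 / (q - 1)) := by
  have h := (hasSum_geometric_of_lt_one (r := q⁻¹) (by positivity)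
    (inv_lt_one_of_one_lt₀ hq)).mul_right q⁻¹
  have h0 : q - 1 ≠ 0 := by linarith
  have h1 : q ≠ 0 := by linarith
  have hfun : (fun n : ℕ => (1 : ℝ) / q ^ (n + 1)) = fun n => q⁻¹ ^ n * q⁻¹ := by
    ext n
    rw [pow_succ, one_div, mul_inv, inv_pow]
  have hval : 1 / (q - 1) = (1 - q⁻¹)⁻¹ * q⁻¹ := by
    rw [← mul_inv, sub_mul, inv_mul_cancel₀ h1, one_mul, one_div]
  rwa [hfun, hval]

lemma digit_div_le {q : ℝ} (hq : 1 < q) {a : ℕ → ℕ} (ha : ∀ n, a n ≤ 1) (n : ℕ) :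
    (a n : ℝ) / q ^ (n + 1) ≤ 1 / q ^ (n + 1) := by
  have : (a n : ℝ) ≤ 1 := by exact_mod_cast ha n
  gcongr

lemma summable_digits {q : ℝ} (hq : 1 < q) {a : ℕ → ℕ} (ha : ∀ n, a n ≤ 1) :
    Summable (fun n : ℕ => (a n : ℝ) / q ^ (n + 1)) :=
  (hasSum_div_pow hq).summable.of_nonneg_of_le (fun n => by positivity) (digit_div_le hq ha)

lemma baseValue_nonneg {q : ℝ} (hq : 1 < q) (a : ℕ → ℕ) : 0 ≤ baseValue q a :=
  tsum_nonneg fun n => by positivity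

lemma baseValue_le {q : ℝ} (hq : 1 < q) {a : ℕ → ℕ} (ha : ∀ n, a n ≤ 1) :
    baseValue q a ≤ 1 / (q - 1) := by
  rw [← (hasSum_div_pow hq).tsum_eq]
  exact (summable_digits hq ha).tsum_le_tsum (digit_div_le hq ha) (hasSum_div_pow hq).summable

lemma baseValue_reflection {q : ℝ} (hq : 1 < q) {a : ℕ → ℕ} (ha : ∀ n, a n ≤ 1) :
    baseValue q (reflection a) = 1 / (q - 1) - baseValue q a := by
  rw [← (hasSum_div_pow hq).tsum_eq, baseValue, baseValue,
    ← (hasSum_div_pow hq).summable.tsum_sub (summable_digits hq ha)]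
  congr 1
  ext n
  rw [reflection, Nat.cast_sub (ha n)]
  push_cast
  ring

lemma baseValue_eq_sum_add {q : ℝ} (hq : 1 < q) {a : ℕ → ℕ} (ha : ∀ n, a n ≤ 1) (m : ℕ) :
    baseValue q a = ∑ i ∈ Finset.range m, (a i : ℝ) / q ^ (i + 1) +
      baseValue q (fun n => a (n + m)) / q ^ m := by
  rw [baseValue, ← (summable_digits hq ha).sum_add_tsum_nat_add m, baseValue, ← tsum_div_const]
  congr 2
  ext n
  rw [div_div, ← pow_add]
  congr 2
  ring

lemma baseValue_step {q : ℝ} (hq : 1 < q) {a : ℕ → ℕ} (ha : ∀ n, a n ≤ 1) :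
    baseValue q a = (a 0 + baseValue q (fun n => a (n + 1))) / q := by
  rw [baseValue_eq_sum_add hq ha 1]
  simp [add_div]

lemma baseValue_seqCons {q : ℝ} (hq : 1 < q) {d : ℕ} {a : ℕ → ℕ} (hd : d ≤ 1)
    (ha : ∀ n, a n ≤ 1) : baseValue q (seqCons d a) = (d + baseValue q a) / q :=
  baseValue_step hq (seqCons_le hd ha)

/-- The sequence contains no `m` consecutive equal digits. -/
def NoRun (m : ℕ) (a : ℕ → ℕ) : Prop :=
  ∀ n, (∃ i < m, a (n + i) = 0) ∧ ∃ i < m, a (n + i) = 1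

lemma baseValue_lt_one {q : ℝ} (hq : 1 < q) {m : ℕ}
    (hm : ∑ i ∈ Finset.range m, 1 / q ^ (i + 1) < 1) {a : ℕ → ℕ} (ha : ∀ n, a n ≤ 1)
    (hrun : ∀ n, ∃ i < m, a (n + i) = 0) : baseValue q a < 1 := by
  have hq0 : 0 < q := by linarith
  have hm0 : m ≠ 0 := by
    rintro rfl
    obtain ⟨i, hi, -⟩ := hrun 0
    omega
  have hstep : ∀ b : ℕ → ℕ, (∀ n, b n ≤ 1) → (∃ i < m, b i = 0) → baseValue q b - 1 ≤
      (∑ i ∈ Finset.range m, 1 / q ^ (i + 1) - 1) +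
        (baseValue q (fun n => b (n + m)) - 1) / q ^ m := by
    intro b hb hb0
    obtain ⟨i, hi, hbi⟩ := hb0
    have hsum : ∑ j ∈ Finset.range m, (b j : ℝ) / q ^ (j + 1) + 1 / q ^ (i + 1) ≤
        ∑ j ∈ Finset.range m, 1 / q ^ (j + 1) := by
      rw [← Finset.add_sum_erase _ _ (Finset.mem_range.2 hi),
        ← Finset.add_sum_erase _ (fun j => 1 / q ^ (j + 1)) (Finset.mem_range.2 hi), hbi]
      have := Finset.sum_le_sum fun j (_ : j ∈ (Finset.range m).erase i) => digit_div_le hq hb j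
      simp only [Nat.cast_zero, zero_div]
      linarith
    have hpow : 1 / q ^ m ≤ 1 / q ^ (i + 1) :=
      one_div_le_one_div_of_le (by positivity) (pow_le_pow_right₀ hq.le hi)
    rw [baseValue_eq_sum_add hq hb m, sub_div]
    linarith
  have hiter : ∀ n : ℕ, ∀ b : ℕ → ℕ, (∀ n, b n ≤ 1) → (∀ n, ∃ i < m, b (n + i) = 0) →
      baseValue q b - 1 ≤ (1 / (q - 1)) * ((1 / q ^ m) ^ n) := by
    intro n
    induction n with
    | zero =>
      intro b hb _
      have := baseValue_le hq hb
      rw [pow_zero, mul_one]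
      linarith
    | succ n ih =>
      intro b hb hb0
      have h1 := hstep b hb (by simpa using hb0 0)
      have h2 := ih (fun n => b (n + m)) (fun n => hb _) fun n => by
        obtain ⟨i, hi, h⟩ := hb0 (n + m)
        exact ⟨i, hi, by rw [← h]; congr 1; ring⟩
      have h3 := div_le_div_of_nonneg_right h2 (pow_pos hq0 m).le
      rw [pow_succ]
      calc _ ≤ _ := h1
        _ ≤ 1 / (q - 1) * (1 / q ^ m) ^ n / q ^ m := by linarith
        _ = _ := by ring
  have hlim : Tendsto (fun n : ℕ => (1 / (q - 1)) * ((1 / q ^ m) ^ n)) atTop (𝓝 0) := by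
    simpa using (tendsto_pow_atTop_nhds_zero_of_lt_one (r := 1 / q ^ m) (by positivity)
      ((div_lt_one (by positivity)).2 (one_lt_pow₀ hq hm0))).const_mul (1 / (q - 1))
  have htail := ge_of_tendsto' hlim fun n => hiter n (fun n => a (n + m)) (fun n => ha _)
    fun n => by
      obtain ⟨i, hi, h⟩ := hrun (n + m)
      exact ⟨i, hi, by rw [← h]; congr 1; ring⟩
  have h1 := hstep a ha (by simpa using hrun 0)
  have := div_nonpos_of_nonpos_of_nonneg htail (pow_pos hq0 m).le
  linarith

/-- A sufficient condition for being the only expansion of its value: tails after a `0`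
are below `1`, and so are the reflections of tails after a `1`. -/
def Admissible (q : ℝ) (a : ℕ → ℕ) : Prop :=
  ∀ n, a n ≤ 1 ∧ (a n = 0 → baseValue q (fun i => a (i + (n + 1))) < 1) ∧
    (a n = 1 → 1 / (q - 1) - baseValue q (fun i => a (i + (n + 1))) < 1)

lemma Admissible.eq {q : ℝ} (hq : 1 < q) {a c : ℕ → ℕ} (ha : Admissible q a)
    (hc : ∀ n, c n ≤ 1) (h : baseValue q c = baseValue q a) : c = a := by
  have hq0 : 0 < q := by linarith
  have hstep : ∀ a c : ℕ → ℕ, Admissible q a → (∀ n, c n ≤ 1) → baseValue q c = baseValue q a →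
      c 0 = a 0 ∧ baseValue q (fun n => c (n + 1)) = baseValue q (fun n => a (n + 1)) := by
    intro a c ha hc h
    rw [baseValue_step hq hc, baseValue_step hq fun n => (ha n).1, div_left_inj' hq0.ne'] at h
    have hc0 := baseValue_nonneg hq fun n => c (n + 1)
    have hc1 := baseValue_le hq (a := fun n => c (n + 1)) fun n => hc _
    obtain ⟨h1, h2, h3⟩ := ha 0
    have h4 := hc 0
    have hdig : c 0 = a 0 := by
      interval_cases hx : a 0 <;> interval_cases hy : c 0 <;> simp at h h2 ⊢
      · linarith
      · linarith [h3 rfl]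
    rw [hdig] at h
    exact ⟨hdig, by linarith⟩
  have htail : ∀ n, baseValue q (fun i => c (i + n)) = baseValue q (fun i => a (i + n)) ∧
      c n = a n := by
    have hadm : ∀ n, Admissible q fun i => a (i + n) := fun n i => by
      have := ha (i + n)
      simpa only [add_assoc, add_comm, add_left_comm] using this
    intro n
    induction n with
    | zero => exact ⟨h, (hstep a c ha hc h).1⟩
    | succ n ih =>
      have h1 : baseValue q (fun i => c (i + (n + 1))) = baseValue q (fun i => a (i + (n + 1))) := by
        have := (hstep _ (fun i => c (i + n)) (hadm n) (fun i => hc _) ih.1).2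
        simpa only [add_assoc, add_comm, add_left_comm] using this
      refine ⟨h1, ?_⟩
      have := (hstep _ (fun i => c (i + (n + 1))) (hadm (n + 1)) (fun i => hc _) h1).1
      simpa using this
  exact funext fun n => (htail n).2

lemma Admissible.reflection {q : ℝ} (hq : 1 < q) {a : ℕ → ℕ} (ha : Admissible q a) :
    Admissible q (reflection a) := by
  intro n
  obtain ⟨h1, h2, h3⟩ := ha n
  have hval := baseValue_reflection hq (a := fun i => a (i + (n + 1))) fun i => (ha _).1
  have hshift : (fun i => _root_.reflection a (i + (n + 1))) =
    _root_.reflection fun i => a (i + (n + 1)) := rfl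
  rw [hshift, hval]
  refine ⟨reflection_le a n, fun h => h3 ?_, fun h => ?_⟩
  · simp only [_root_.reflection] at h
    omega
  · have := h2 (by simp only [_root_.reflection] at h; omega)
    linarith

lemma Admissible.seqCons_zero {q : ℝ} {a : ℕ → ℕ} (ha : Admissible q a)
    (h : baseValue q a < 1) : Admissible q (seqCons 0 a) := by
  rintro (_ | n)
  · exact ⟨zero_le_one, fun _ => h, fun h => absurd h zero_ne_one⟩
  · exact ha n

lemma NoRun.admissible {q : ℝ} (hq : 1 < q) {m : ℕ}
    (hm : ∑ i ∈ Finset.range m, 1 / q ^ (i + 1) < 1) {a : ℕ → ℕ} (ha : ∀ n, a n ≤ 1)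
    (hrun : NoRun m a) : Admissible q a := by
  intro n
  refine ⟨ha n, fun _ => baseValue_lt_one hq hm (fun _ => ha _) fun k => ?_, fun _ => ?_⟩
  · obtain ⟨i, hi, h⟩ := (hrun (k + (n + 1))).1
    exact ⟨i, hi, by rw [← h]; congr 1; ring⟩
  · rw [← baseValue_reflection hq fun _ => ha _]
    refine baseValue_lt_one hq hm (reflection_le _) fun k => ?_
    obtain ⟨i, hi, h⟩ := (hrun (k + (n + 1))).2
    refine ⟨i, hi, ?_⟩
    have : a (k + i + (n + 1)) = 1 := by
      rw [add_right_comm, h]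
    simp only [reflection, this, Nat.sub_self]

lemma exists_admissible_zeros {q : ℝ} (hq : 1 < q) {a : ℕ → ℕ} (ha : Admissible q a)
    (h : baseValue q a < 1) (k : ℕ) :
    ∃ b, Admissible q b ∧ baseValue q b < 1 ∧ baseValue q b * q ^ k = baseValue q a := by
  induction k with
  | zero => exact ⟨a, ha, h, by simp⟩
  | succ k ih =>
    obtain ⟨b, hb, hb1, hbk⟩ := ih
    have hq0 : q ≠ 0 := by linarith
    have hval := baseValue_seqCons hq zero_le_one fun n => (hb n).1
    rw [Nat.cast_zero, zero_add] at hval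
    refine ⟨_, hb.seqCons_zero hb1, ?_, ?_⟩
    · rw [hval, div_lt_one (by linarith)]
      linarith
    · rw [hval, ← hbk, pow_succ]
      field_simp

lemma mem_B_two_of_admissible {q : ℝ} (hq : q ∈ Set.Ioo ((1 + Real.sqrt 5) / 2) 2)
    {a b : ℕ → ℕ} (ha : Admissible q a) (hb : Admissible q b)
    (hab : 1 + baseValue q a = baseValue q b) : q ∈ B 2 := by
  have hq1 : 1 < q := by
    have : 1 ≤ Real.sqrt 5 := Real.one_le_sqrt.2 (by norm_num)
    linarith [hq.1]
  have hq0 : q ≠ 0 := by linarith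
  have ha1 := fun n => (ha n).1
  have hb1 := fun n => (hb n).1
  have hva := baseValue_seqCons hq1 le_rfl ha1
  have hvb := baseValue_seqCons hq1 zero_le_one hb1
  have hval : baseValue q (seqCons 1 a) = baseValue q (seqCons 0 b) := by
    rw [hva, hvb, ← hab]
    simp
  refine ⟨hq, baseValue q (seqCons 1 a), ⟨baseValue_nonneg hq1 _,
    baseValue_le hq1 (seqCons_le le_rfl ha1)⟩, ?_⟩
  have hset : expansionsOf q (baseValue q (seqCons 1 a)) = {seqCons 1 a, seqCons 0 b} := by
    ext c
    constructor
    · rintro ⟨hc, hx⟩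
      change _ = baseValue q c at hx
      have hcons : c = seqCons (c 0) fun n => c (n + 1) := by
        ext n
        cases n <;> rfl
      have hstep := baseValue_step hq1 hc
      have h0 := hc 0
      interval_cases h : c 0
      · right
        rw [Set.mem_singleton_iff, hcons, hb.eq hq1 (fun _ => hc _)]
        rw [← hx, hval, hvb, div_left_inj' hq0] at hstep
        linarith
      · left
        rw [hcons, ha.eq hq1 (fun _ => hc _)]
        rw [← hx, hva, div_left_inj' hq0] at hstep
        linarith
    · rintro (rfl | rfl)
      · exact ⟨seqCons_le le_rfl ha1, rfl⟩
      · exact ⟨seqCons_le zero_le_one hb1, hval⟩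
  have hne : seqCons 1 a ≠ seqCons 0 b := fun h => one_ne_zero (congrFun h 0)
  rw [hset, Cardinal.mk_insert (by simpa using hne), Cardinal.mk_singleton]
  norm_num

lemma mem_B_two_of_noRun {q : ℝ} (hq : q ∈ Set.Ioo ((1 + Real.sqrt 5) / 2) 2) {m : ℕ}
    (hm : ∑ i ∈ Finset.range m, 1 / q ^ (i + 1) < 1) {a b : ℕ → ℕ} (ha : ∀ n, a n ≤ 1)
    (hb : ∀ n, b n ≤ 1) (hra : NoRun m a) (hrb : NoRun m b) (k : ℕ)
    (hab : baseValue q a + baseValue q b = q ^ k * (1 / (q - 1) - 1)) : q ∈ B 2 := by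
  have hq1 : 1 < q := by
    have : 1 ≤ Real.sqrt 5 := Real.one_le_sqrt.2 (by norm_num)
    linarith [hq.1]
  obtain ⟨a', ha', -, hak⟩ := exists_admissible_zeros hq1 (hra.admissible hq1 hm ha)
    (baseValue_lt_one hq1 hm ha fun n => (hra n).1) k
  obtain ⟨b', hb', -, hbk⟩ := exists_admissible_zeros hq1 (hrb.admissible hq1 hm hb)
    (baseValue_lt_one hq1 hm hb fun n => (hrb n).1) k
  refine mem_B_two_of_admissible hq ha' (hb'.reflection hq1) ?_
  rw [baseValue_reflection hq1 fun n => (hb' n).1]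
  have hqk : 0 < q ^ k := by positivity
  have : baseValue q a' + baseValue q b' = 1 / (q - 1) - 1 :=
    mul_left_cancel₀ hqk.ne' (by rw [← hab, ← hak, ← hbk]; ring)
  linarith

/-- Digit sequences which can follow a single `0` without creating three consecutive equal
digits. -/
def afterZero : Set (ℕ → ℕ) := {a | (∀ n, a n ≤ 1) ∧ NoRun 3 a ∧ (a 0 = 1 ∨ a 1 = 1)}

lemma isCompact_afterZero : IsCompact afterZero := by
  have hpi : IsCompact (Set.pi Set.univ fun _ : ℕ => Set.Iic (1 : ℕ)) :=
    isCompact_univ_pi fun _ => (Set.finite_Iic 1).isCompact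
  have hdig : ∀ i d : ℕ, IsClosed {a : ℕ → ℕ | a i = d} := fun i d =>
    isClosed_eq (continuous_apply i) continuous_const
  have hex : ∀ n d : ℕ, IsClosed {a : ℕ → ℕ | ∃ i < 3, a (n + i) = d} := by
    intro n d
    have : {a : ℕ → ℕ | ∃ i < 3, a (n + i) = d} = ⋃ i ∈ Set.Iio 3, {a | a (n + i) = d} := by
      ext a
      simp
    rw [this]
    exact (Set.finite_Iio 3).isClosed_biUnion fun i _ => hdig _ _
  have hrun : IsClosed {a : ℕ → ℕ | NoRun 3 a} := by
    simp only [NoRun, Set.ofPred_forall, Set.ofPred_and]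
    exact isClosed_iInter fun n => (hex n 0).inter (hex n 1)
  convert hpi.inter_right (hrun.inter ((hdig 0 1).union (hdig 1 1))) using 1
  ext a
  simp [afterZero, Pi.le_def]

lemma continuousOn_baseValue {q : ℝ} (hq : 1 < q) : ContinuousOn (baseValue q) afterZero := by
  refine continuousOn_tsum (u := fun n : ℕ => 1 / q ^ (n + 1)) (fun n => ?_)
    (hasSum_div_pow hq).summable fun n a ha => ?_
  · exact (((continuous_of_discreteTopology (f := fun d : ℕ => (d : ℝ))).comp
      (continuous_apply n)).div_const _).continuousOn
  · rw [Real.norm_of_nonneg (by positivity)]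
    exact digit_div_le hq ha.1 n

lemma seqCons_one_reflection_mem {a : ℕ → ℕ} (ha : a ∈ afterZero) :
    seqCons 1 (reflection a) ∈ afterZero := by
  obtain ⟨h1, h2, h3⟩ := ha
  refine ⟨seqCons_le le_rfl (reflection_le a), ?_, Or.inl rfl⟩
  rintro (_ | n)
  · refine ⟨?_, 0, by norm_num, rfl⟩
    rcases h3 with h3 | h3
    · exact ⟨1, by norm_num, by simp [seqCons, reflection, h3]⟩
    · exact ⟨2, by norm_num, by simp [seqCons, reflection, h3]⟩
  · obtain ⟨⟨i, hi, hi0⟩, j, hj, hj1⟩ := h2 n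
    refine ⟨⟨j, hj, ?_⟩, i, hi, ?_⟩
    · rw [add_right_comm]
      simp [seqCons, reflection, hj1]
    · rw [add_right_comm]
      simp [seqCons, reflection, hi0]

lemma seqCons_zero_mem {a : ℕ → ℕ} (ha : a ∈ afterZero) (ha0 : a 0 = 1) :
    seqCons 0 a ∈ afterZero := by
  obtain ⟨h1, h2, -⟩ := ha
  refine ⟨seqCons_le zero_le_one h1, ?_, Or.inr ha0⟩
  rintro (_ | n)
  · exact ⟨⟨0, by norm_num, rfl⟩, 1, by norm_num, ha0⟩
  · obtain ⟨⟨i, hi, hi0⟩, j, hj, hj1⟩ := h2 n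
    refine ⟨⟨i, hi, ?_⟩, j, hj, ?_⟩
    · rw [add_right_comm]
      exact hi0
    · rw [add_right_comm]
      exact hj1

lemma noRun_alternating (d : ℕ) : NoRun 2 fun n => (n + d) % 2 := by
  intro n
  rcases Nat.mod_two_eq_zero_or_one (n + d) with h | h
  · exact ⟨⟨0, by norm_num, h⟩, 1, by norm_num, by change (n + 1 + d) % 2 = 1; omega⟩
  · exact ⟨⟨1, by norm_num, by change (n + 1 + d) % 2 = 0; omega⟩, 0, by norm_num, h⟩

lemma alternating_mem_afterZero : (fun n => n % 2) ∈ afterZero := by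
  refine ⟨fun n => Nat.le_of_lt_succ (Nat.mod_lt n two_pos), fun n => ?_, Or.inr rfl⟩
  obtain ⟨⟨i, hi, hi0⟩, j, hj, hj1⟩ := noRun_alternating 0 n
  exact ⟨⟨i, by omega, hi0⟩, j, by omega, hj1⟩

lemma exists_baseValue_add_eq {q : ℝ} (hq1 : 1 < q) (hq2 : q < 2) {s : ℝ}
    (hs1 : 2 * q ≤ s * (q ^ 3 - 1)) (hs2 : s * (q ^ 3 - 1) ≤ 2 * (q ^ 2 + q)) :
    ∃ a ∈ afterZero, ∃ b ∈ afterZero, baseValue q a + baseValue q b = s := by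
  have hq0 : 0 < q := by linarith
  have hD : 0 < q ^ 3 - 1 := by nlinarith [one_lt_pow₀ hq1 (n := 3) (by norm_num)]
  have hc : 0 < q - 1 := by linarith
  obtain ⟨f, hf⟩ : ∃ f : ℝ → ℝ, f = fun x => (2 * (q ^ 3 - 1) * x - (q ^ 2 + 2 * q)) / q ^ 2 :=
    ⟨_, rfl⟩
  have hcompact : IsCompact (f '' (baseValue q '' afterZero)) := by
    refine (isCompact_afterZero.image_of_continuousOn (continuousOn_baseValue hq1)).image ?_
    rw [hf]
    fun_prop
  have hr2 : 1 ≤ q⁻¹ + 2 * q⁻¹ ^ 2 := by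
    have : q⁻¹ + 2 * q⁻¹ ^ 2 = (q + 2) / q ^ 2 := by field_simp
    rw [this, le_div_iff₀ (by positivity)]
    nlinarith
  have hv1 : ∀ a ∈ afterZero,
      baseValue q (seqCons 1 (reflection a)) = (1 + (1 / (q - 1) - baseValue q a)) / q := by
    intro a ha
    rw [baseValue_seqCons hq1 le_rfl (reflection_le a), baseValue_reflection hq1 ha.1]
    simp
  obtain ⟨_, ⟨_, ⟨a, ha, rfl⟩, rfl⟩, _, ⟨_, ⟨b, hb, rfl⟩, rfl⟩, hab⟩ := exists_add_eq
    (r := q⁻¹) (by positivity) (inv_lt_one_of_one_lt₀ hq1) hr2 hcompact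
    ⟨_, _, ⟨_, alternating_mem_afterZero, rfl⟩, rfl⟩
    (by
      rintro _ ⟨_, ⟨a, ha, rfl⟩, rfl⟩
      refine ⟨_, ⟨_, seqCons_one_reflection_mem ha, rfl⟩, ?_⟩
      rw [hv1 a ha, hf]
      field_simp
      ring)
    (by
      rintro _ ⟨_, ⟨a, ha, rfl⟩, rfl⟩
      refine ⟨_, ⟨_, seqCons_zero_mem (seqCons_one_reflection_mem ha) rfl, rfl⟩, ?_⟩
      rw [baseValue_seqCons hq1 zero_le_one (seqCons_one_reflection_mem ha).1, hv1 a ha, hf]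
      push_cast
      field_simp
      ring)
    (z := (2 * (q ^ 3 - 1) * s - 2 * (q ^ 2 + 2 * q)) / q ^ 2)
    (by
      rw [abs_le, le_div_iff₀ (by positivity), div_le_iff₀ (by positivity)]
      constructor <;> nlinarith)
  refine ⟨a, ha, b, hb, ?_⟩
  rw [hf] at hab
  field_simp at hab
  exact mul_left_cancel₀ hD.ne' (by linarith)

theorem stmt17 (T : ℝ) (hT : T ∈ Set.Ioo (1:ℝ) 2)
    (hTeq : T ^ 3 = T ^ 2 + T + 1) :
    Set.Ico T 2 ⊆ B 2 := by
  rintro q ⟨hTq, hq2⟩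
  have hT1 := hT.1
  have hq1 : 1 < q := by linarith
  have hq0 : 0 < q := by linarith
  have hc : 0 < q - 1 := by linarith
  have hGT : (1 + Real.sqrt 5) / 2 < T := by
    have h5 : Real.sqrt 5 < 2 * T - 1 := by
      rw [Real.sqrt_lt' (by linarith)]
      nlinarith
    linarith
  have hq : q ∈ Set.Ioo ((1 + Real.sqrt 5) / 2) 2 := ⟨by linarith, hq2⟩
  rcases hTq.eq_or_lt with rfl | hTq
  · have hdig : ∀ d n : ℕ, (n + d) % 2 ≤ 1 := fun d n => by omega
    have hm : ∑ i ∈ Finset.range 2, 1 / T ^ (i + 1) < 1 := by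
      have : ∑ i ∈ Finset.range 2, 1 / T ^ (i + 1) = (T + 1) / T ^ 2 := by
        simp [Finset.sum_range_succ]
        field_simp
      rw [this, div_lt_one (by positivity)]
      nlinarith
    refine mem_B_two_of_noRun hq hm (hdig 0) (hdig 1) (noRun_alternating 0)
      (noRun_alternating 1) 3 ?_
    have hrefl : (fun n => (n + 1) % 2) = reflection fun n => (n + 0) % 2 := by
      ext n
      simp only [reflection]
      omega
    rw [hrefl, baseValue_reflection hq1 (hdig 0)]
    field_simp
    nlinarith
  · have hT3 : q ^ 2 + q + 1 < q ^ 3 := by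
      nlinarith [mul_pos (sub_pos.2 hTq) hq0, mul_pos (sub_pos.2 hTq) (sub_pos.2 hT1),
        mul_pos (mul_pos (sub_pos.2 hTq) hq0) hq0, mul_pos (sub_pos.2 hTq) hc]
    have hm : ∑ i ∈ Finset.range 3, 1 / q ^ (i + 1) < 1 := by
      have : ∑ i ∈ Finset.range 3, 1 / q ^ (i + 1) = (q ^ 2 + q + 1) / q ^ 3 := by
        simp [Finset.sum_range_succ]
        field_simp
      rwa [this, div_lt_one (by positivity)]
    have hD : 0 < q ^ 3 - 1 := by nlinarith
    have hs : 1 / (q - 1) - 1 = (2 - q) / (q - 1) := by field_simp; ring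
    have hs0 : 0 < 1 / (q - 1) - 1 := by
      rw [hs]
      exact div_pos (by linarith) hc
    have hsD : (1 / (q - 1) - 1) * (q ^ 3 - 1) = (2 - q) * (q ^ 2 + q + 1) := by
      rw [hs]
      field_simp
      ring
    obtain ⟨k, hk1, hk2⟩ := exists_nat_pow_near
      (x := 2 * (q ^ 2 + q) / ((1 / (q - 1) - 1) * (q ^ 3 - 1))) (y := q)
      (by
        rw [le_div_iff₀ (by positivity), hsD]
        nlinarith) hq1
    rw [le_div_iff₀ (by positivity)] at hk1
    rw [div_lt_iff₀ (by positivity), pow_succ q k] at hk2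
    obtain ⟨a, ha, b, hb, hab⟩ := exists_baseValue_add_eq hq1 hq2
      (s := q ^ k * (1 / (q - 1) - 1))
      (le_of_mul_le_mul_left (a := q) (by nlinarith) hq0) (by linarith)
    exact mem_B_two_of_noRun hq hm ha.1 hb.1 ha.2.1 hb.2.1 k hab
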